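/- arXiv:1904.12405 — 9 statements merged into one kernel-verified Lean document; each statement's English description precedes it below -/
import Mathlib

section
/- Let γ : F₁ × F₁ → F₃ be an alternating P-bilinear map such that ψ₃(d₂x₂, γ(x₁, x₁′)) + ψ̄₄(x₂, α(x₁, x₁′)) = 0 for all x₁, x₁′ ∈ F₁ and x₂ ∈ F₂. Then for all x₁ ∈ F₁ and x₂ ∈ F₂: 3·d₁(x₁)·ψ₄(x₂) = ψ̄₄(3·ψ₁†(x₁, d₂x₂) − d₃(γ(x₁, d₂x₂)), x₂). -/
open QuadraticMap LinearMap Submodule Function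

theorem stmt_10
    (P : Type*) [CommRing P] [IsNoetherianRing P]
    (F1 F2 F3 F4 : Type*)
    [AddCommGroup F1] [Module P F1] [Module.Free P F1] [Module.Finite P F1]
    [AddCommGroup F2] [Module P F2] [Module.Free P F2] [Module.Finite P F2]
    [AddCommGroup F3] [Module P F3] [Module.Free P F3] [Module.Finite P F3]
    [AddCommGroup F4] [Module P F4] [Module.Free P F4] [Module.Finite P F4]
    (d1 : F1 →ₗ[P] P) (d2 : F2 →ₗ[P] F1) (d3 : F3 →ₗ[P] F2) (d4 : F4 →ₗ[P] F3)
    (hd21 : ∀ x2, d1 (d2 x2) = 0) (hd32 : ∀ x3, d2 (d3 x3) = 0)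
    (hd43 : ∀ x4, d3 (d4 x4) = 0)
    (hinj4 : Function.Injective d4)
    (hex3 : LinearMap.range d4 = LinearMap.ker d3)
    (hex2 : LinearMap.range d3 = LinearMap.ker d2)
    (hex1 : LinearMap.range d2 = LinearMap.ker d1)
    (hrank : Nonempty (F4 ≃ₗ[P] P))
    (φ0 : P ≃ₗ[P] (F4 →ₗ[P] F4)) (φ1 : F1 ≃ₗ[P] (F3 →ₗ[P] F4))
    (φ2 : F2 ≃ₗ[P] (F2 →ₗ[P] F4)) (φ3 : F3 ≃ₗ[P] (F1 →ₗ[P] F4))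
    (φ4 : F4 ≃ₗ[P] (P →ₗ[P] F4))
    (hφ1 : ∀ x1 y4, φ0 (d1 x1) y4 = φ1 x1 (d4 y4))
    (hφ2 : ∀ x2 y3, φ1 (d2 x2) y3 = φ2 x2 (d3 y3))
    (hφ3 : ∀ x3 y2, φ2 (d3 x3) y2 = φ3 x3 (d2 y2))
    (hφ4 : ∀ x4 y1, φ3 (d4 x4) y1 = φ4 x4 (d1 y1))
    (ψ1d : F1 →ₗ[P] F1 →ₗ[P] F2) (hψ1alt : ∀ x1, ψ1d x1 x1 = 0)
    (ψ2d : F1 →ₗ[P] F2 →ₗ[P] F3)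
    (ψ3 : F1 →ₗ[P] F3 →ₗ[P] F4)
    (ψ4 : QuadraticMap P F2 F4)
    (hA2 : ∀ x1 x4, ψ3 x1 (d4 x4) = d1 x1 • x4)
    (hA3 : ∀ x2 x3, polar ψ4 x2 (d3 x3) = - ψ3 (d2 x2) x3)
    (hnewb : ∀ x1 y1, d2 (ψ1d x1 y1) = d1 x1 • y1 - d1 y1 • x1)
    (hbb : ∀ x1 x2, d3 (ψ2d x1 x2) = d1 x1 • x2 - ψ1d x1 (d2 x2))
    (hcc : ∀ x1 x3, d4 (ψ3 x1 x3) = d1 x1 • x3 - ψ2d x1 (d3 x3))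
    (hdd : ∀ x2, d4 (ψ4 x2) = ψ2d (d2 x2) x2)
    (hiso1 : Function.Bijective ψ3)
    (hiso2 : Function.Bijective (polarBilin ψ4))
    (hiso3 : Function.Bijective ψ3.flip)
    (α : F1 →ₗ[P] F1 →ₗ[P] F2) (hαalt : ∀ x1, α x1 x1 = 0)
    (hα : ∀ x1 x1' x2, polar ψ4 x2 (α x1 x1') =
      (2 : ℤ) • polar ψ4 (ψ1d x1 x1') x2 + ψ3 x1' (ψ2d x1 x2) - ψ3 x1 (ψ2d x1' x2))
    (γ : F1 →ₗ[P] F1 →ₗ[P] F3) (hγalt : ∀ x1, γ x1 x1 = 0)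
    (hγ : ∀ x1 x1' x2, ψ3 (d2 x2) (γ x1 x1') + polar ψ4 x2 (α x1 x1') = 0)
    : ∀ x1 x2, (3 : ℤ) • (d1 x1 • ψ4 x2) =
        polar ψ4 ((3 : ℤ) • ψ1d x1 (d2 x2) - d3 (γ x1 (d2 x2))) x2 := by
  intro x1 x2
  have key : -ψ3 (d2 x2) (ψ2d x1 x2) =
      d1 x1 • (2 : ℤ) • ψ4 x2 - polar ψ4 (ψ1d x1 (d2 x2)) x2 := by
    rw [← hA3, hbb, polar_sub_right, polar_smul_right, QuadraticMap.polar_self,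
      QuadraticMap.polar_comm ψ4 x2, ofNat_smul_eq_nsmul ℤ 2]
  have hγ' : polar ψ4 (d3 (γ x1 (d2 x2))) x2 = polar ψ4 x2 (α x1 (d2 x2)) := by
    rw [QuadraticMap.polar_comm, hA3]
    exact neg_eq_of_add_eq_zero_right (hγ x1 (d2 x2) x2)
  have hψ : ψ3 x1 (ψ2d (d2 x2) x2) = d1 x1 • ψ4 x2 := by rw [← hdd, hA2]
  rw [polar_sub_left, polar_smul_left_of_tower, hγ', hα, hψ]
  rw [smul_comm] at key
  linear_combination (norm := module) -key
end

section
/- There exists a quadratic map β : F₁ → Hom_P(F₁, F₄) such that d₁(w₁)·(β(x₁))(z₁) = ψ̄₄(ψ₁(x₁,z₁), ψ₁(x₁,w₁)) + N·d₁(z₁)·ψ₃(w₁, χ(x₁)) for all x₁, z₁, w₁ ∈ F₁. -/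
open QuadraticMap LinearMap Submodule Function

theorem LinearMap.exists_comp_eq_of_forall_mem_range {R M N K : Type*} [CommRing R]
    [AddCommGroup M] [Module R M] [AddCommGroup N] [Module R N] [AddCommGroup K] [Module R K]
    (L : N →ₗ[R] K) (hL : Function.Injective L) (g : M →ₗ[R] K)
    (hg : ∀ x, g x ∈ LinearMap.range L) : ∃ b : M →ₗ[R] N, L ∘ₗ b = g := by
  refine ⟨(LinearEquiv.ofInjective L hL).symm.toLinearMap ∘ₗ g.codRestrict _ hg, ?_⟩
  ext x
  exact congrArg Subtype.val
    ((LinearEquiv.ofInjective L hL).apply_symm_apply (g.codRestrict _ hg x))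

theorem QuadraticMap.exists_compQuadraticMap_eq_of_forall_mem_range {R M N K : Type*} [CommRing R]
    [AddCommGroup M] [Module R M] [AddCommGroup N] [Module R N] [AddCommGroup K] [Module R K]
    (L : N →ₗ[R] K) (hL : Function.Injective L) (Q : QuadraticMap R M K)
    (hQ : ∀ x, Q x ∈ LinearMap.range L) : ∃ β : QuadraticMap R M N, ∀ x, L (β x) = Q x := by
  choose f hf using hQ
  have hpolar (x y : M) : L (f (x + y) - f x - f y) = polar Q x y := by
    simp only [map_sub, hf, polar]
  let B : M →ₗ[R] M →ₗ[R] N := LinearMap.mk₂ R (fun x y => f (x + y) - f x - f y)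
    (fun x x' y => hL <| by rw [map_add]; simp only [hpolar, polar_add_left])
    (fun a x y => hL <| by rw [map_smul]; simp only [hpolar, polar_smul_left])
    (fun x y y' => hL <| by rw [map_add]; simp only [hpolar, polar_add_right])
    (fun a x y => hL <| by rw [map_smul]; simp only [hpolar, polar_smul_right])
  refine ⟨⟨f, fun a x => hL <| by simp only [map_smul, hf, QuadraticMap.map_smul], B, ?_⟩, hf⟩
  intro x y
  simp only [B, LinearMap.mk₂_apply]
  abel

theorem stmt_11
    (P : Type*) [CommRing P] [IsNoetherianRing P]
    (F1 F2 F3 F4 : Type*)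
    [AddCommGroup F1] [Module P F1] [Module.Free P F1] [Module.Finite P F1]
    [AddCommGroup F2] [Module P F2] [Module.Free P F2] [Module.Finite P F2]
    [AddCommGroup F3] [Module P F3] [Module.Free P F3] [Module.Finite P F3]
    [AddCommGroup F4] [Module P F4] [Module.Free P F4] [Module.Finite P F4]
    (d1 : F1 →ₗ[P] P) (d2 : F2 →ₗ[P] F1) (d3 : F3 →ₗ[P] F2) (d4 : F4 →ₗ[P] F3)
    (hd21 : ∀ x2, d1 (d2 x2) = 0) (hd32 : ∀ x3, d2 (d3 x3) = 0)
    (hd43 : ∀ x4, d3 (d4 x4) = 0)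
    (hinj4 : Function.Injective d4)
    (hex3 : LinearMap.range d4 = LinearMap.ker d3)
    (hex2 : LinearMap.range d3 = LinearMap.ker d2)
    (hex1 : LinearMap.range d2 = LinearMap.ker d1)
    (hrank : Nonempty (F4 ≃ₗ[P] P))
    (ψ3 : F1 →ₗ[P] F3 →ₗ[P] F4) (ψ4 : QuadraticMap P F2 F4)
    (hA2 : ∀ x1 x4, ψ3 x1 (d4 x4) = d1 x1 • x4)
    (hA3 : ∀ x2 x3, polar ψ4 x2 (d3 x3) = - ψ3 (d2 x2) x3)
    (hiso1 : Function.Bijective ψ3)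
    (hiso2 : Function.Bijective (polarBilin ψ4))
    (hiso3 : Function.Bijective ψ3.flip)
    (hreg : ∃ x1, d1 x1 ∈ nonZeroDivisors P)
    (N : ℤ) (ψ1 : F1 →ₗ[P] F1 →ₗ[P] F2)
    (hcompat1 : ∀ x1 y1, d2 (ψ1 x1 y1) = N • (d1 x1 • y1 - d1 y1 • x1))
    (hcompat2 : ∀ x1 x2, polar ψ4 (ψ1 x1 (d2 x2)) x2 = N • (d1 x1 • ψ4 x2))
    (χ : QuadraticMap P F1 F3)
    (hχ : ∀ x1, d3 (χ x1) = ψ1 x1 x1)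
    : ∃ β : QuadraticMap P F1 (F1 →ₗ[P] F4),
      ∀ x1 z1 w1, d1 w1 • β x1 z1 =
        polar ψ4 (ψ1 x1 z1) (ψ1 x1 w1) + N • (d1 z1 • ψ3 w1 (χ x1)) := by
  have hL : Function.Injective (ψ3.flip ∘ₗ d4) := hiso3.injective.comp hinj4
  let b : F1 →ₗ[P] F1 →ₗ[P] F1 →ₗ[P] F1 →ₗ[P] F4 :=
    LinearMap.mk₂ P (fun x y => (polarBilin ψ4).compl₁₂ (ψ1 x) (ψ1 y))
      (fun x x' y => by ext; simp) (fun a x y => by ext; simp)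
      (fun x y y' => by ext; simp) (fun a x y => by ext; simp)
  let T : F3 →ₗ[P] F1 →ₗ[P] F1 →ₗ[P] F4 := N • (LinearMap.smulRightₗ d1 ∘ₗ ψ3.flip)
  let Q : QuadraticMap P F1 (F1 →ₗ[P] F1 →ₗ[P] F4) :=
    LinearMap.BilinMap.toQuadraticMap b + T.compQuadraticMap χ
  have hQ (x z w : F1) :
      Q x z w = polar ψ4 (ψ1 x z) (ψ1 x w) + N • (d1 z • ψ3 w (χ x)) := by
    simp [Q, T, b]
  have hpol (x : F1) (u v : F2) :
      polar ψ4 (ψ1 x (d2 u)) v + polar ψ4 (ψ1 x (d2 v)) u = N • (d1 x • polar ψ4 u v) := by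
    have h := hcompat2 x (u + v)
    simp only [map_add, polar_add_left, polar_add_right, hcompat2, QuadraticMap.map_add ψ4 u v,
      smul_add] at h
    linear_combination (norm := module) h
  have hvanish (x z : F1) (v : F2) : Q x z (d2 v) = 0 := by
    have h := hpol x (ψ1 x z) v
    rw [hcompat1, polar_comm ψ4 (ψ1 x (d2 v))] at h
    simp only [map_sub, map_smul, ← Int.cast_smul_eq_zsmul P, polar_smul_left,
      polar_sub_left, smul_sub, ← hχ] at h
    rw [polar_comm ψ4 (d3 (χ x)) v, hA3] at h
    rw [hQ, ← Int.cast_smul_eq_zsmul P]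
    linear_combination (norm := module) h
  have hrange (x z : F1) : Q x z ∈ LinearMap.range (ψ3.flip ∘ₗ d4) := by
    obtain ⟨y, hy⟩ := hiso3.surjective (Q x z)
    have hker : d3 y = 0 := by
      apply hiso2.injective
      ext v
      rw [polarBilin_apply_apply, polar_comm, hA3, ← LinearMap.flip_apply, hy, hvanish]
      simp
    obtain ⟨t, rfl⟩ : y ∈ LinearMap.range d4 := hex3 ▸ hker
    exact ⟨t, hy⟩
  obtain ⟨β, hβ⟩ := QuadraticMap.exists_compQuadraticMap_eq_of_forall_mem_range
    (LinearMap.compRight P (ψ3.flip ∘ₗ d4))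
    (fun f g h => LinearMap.ext fun z => hL (LinearMap.congr_fun h z)) Q
    (fun x => LinearMap.exists_comp_eq_of_forall_mem_range _ hL (Q x) (hrange x))
  refine ⟨β, fun x z w => ?_⟩
  rw [← hQ, ← hβ, ← hA2]
  rfl
end

section
/- There exists a quadratic map r : F₁ → F₄ with polar form r̄ such that d₁(z₁)·r(x₁) = (β(x₁))(z₁) + N·ψ₃(z₁, χ(x₁)) and d₁(z₁)·r̄(x₁,y₁) = (β̄(x₁,y₁))(z₁) + N·ψ₃(z₁, χ̄(x₁,y₁)) for all x₁, y₁, z₁ ∈ F₁ (i.e., the corresponding maps out of D₂F₁ satisfy d₁(z₁)·r(θ₂) = β(θ₂)(z₁) + N·ψ₃(z₁, χ(θ₂)) for every θ₂ ∈ D₂F₁). -/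
open QuadraticMap LinearMap Submodule Function

/-- A quadratic map with values in the range of an injective linear map factors through it. -/
theorem QuadraticMap.exists_compQuadraticMap_eq {R M N N' : Type*} [CommRing R]
    [AddCommGroup M] [Module R M] [AddCommGroup N] [Module R N] [AddCommGroup N'] [Module R N']
    (g : N →ₗ[R] N') (hg : Function.Injective g) (f : QuadraticMap R M N')
    (hf : ∀ x, f x ∈ LinearMap.range g) :
    ∃ q : QuadraticMap R M N, ∀ x, g (q x) = f x := by
  choose q hq using hf
  have hpolar : ∀ x y, g (polar q x y) = polar f x y := fun x y => by
    simp only [polar, map_sub, hq]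
  refine ⟨QuadraticMap.ofPolar q ?_ ?_ ?_, hq⟩
  · intro a x
    exact hg (by rw [map_smul, hq, hq, QuadraticMap.map_smul])
  · intro x x' y
    exact hg (by rw [map_add, hpolar, hpolar, hpolar, QuadraticMap.polar_add_left])
  · intro a x y
    exact hg (by rw [map_smul, hpolar, hpolar, QuadraticMap.polar_smul_left])

theorem stmt_12
    (P : Type*) [CommRing P] [IsNoetherianRing P]
    (F1 F2 F3 F4 : Type*)
    [AddCommGroup F1] [Module P F1] [Module.Free P F1] [Module.Finite P F1]
    [AddCommGroup F2] [Module P F2] [Module.Free P F2] [Module.Finite P F2]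
    [AddCommGroup F3] [Module P F3] [Module.Free P F3] [Module.Finite P F3]
    [AddCommGroup F4] [Module P F4] [Module.Free P F4] [Module.Finite P F4]
    (d1 : F1 →ₗ[P] P) (d2 : F2 →ₗ[P] F1) (d3 : F3 →ₗ[P] F2) (d4 : F4 →ₗ[P] F3)
    (hd21 : ∀ x2, d1 (d2 x2) = 0) (hd32 : ∀ x3, d2 (d3 x3) = 0)
    (hd43 : ∀ x4, d3 (d4 x4) = 0)
    (hinj4 : Function.Injective d4)
    (hex3 : LinearMap.range d4 = LinearMap.ker d3)
    (hex2 : LinearMap.range d3 = LinearMap.ker d2)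
    (hex1 : LinearMap.range d2 = LinearMap.ker d1)
    (hrank : Nonempty (F4 ≃ₗ[P] P))
    (ψ3 : F1 →ₗ[P] F3 →ₗ[P] F4) (ψ4 : QuadraticMap P F2 F4)
    (hA2 : ∀ x1 x4, ψ3 x1 (d4 x4) = d1 x1 • x4)
    (hA3 : ∀ x2 x3, polar ψ4 x2 (d3 x3) = - ψ3 (d2 x2) x3)
    (hiso1 : Function.Bijective ψ3)
    (hiso2 : Function.Bijective (polarBilin ψ4))
    (hiso3 : Function.Bijective ψ3.flip)
    (hreg : ∃ x1, d1 x1 ∈ nonZeroDivisors P)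
    (N : ℤ) (ψ1 : F1 →ₗ[P] F1 →ₗ[P] F2)
    (hcompat1 : ∀ x1 y1, d2 (ψ1 x1 y1) = N • (d1 x1 • y1 - d1 y1 • x1))
    (hcompat2 : ∀ x1 x2, polar ψ4 (ψ1 x1 (d2 x2)) x2 = N • (d1 x1 • ψ4 x2))
    (χ : QuadraticMap P F1 F3)
    (hχ : ∀ x1, d3 (χ x1) = ψ1 x1 x1)
    (β : QuadraticMap P F1 (F1 →ₗ[P] F4))
    (hβ : ∀ x1 z1 w1, d1 w1 • β x1 z1 =
      polar ψ4 (ψ1 x1 z1) (ψ1 x1 w1) + N • (d1 z1 • ψ3 w1 (χ x1)))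
    : ∃ r : QuadraticMap P F1 F4,
      (∀ x1 z1, d1 z1 • r x1 = β x1 z1 + N • ψ3 z1 (χ x1)) ∧
      (∀ x1 y1 z1, d1 z1 • polar r x1 y1 =
        polar β x1 y1 z1 + N • ψ3 z1 (polar χ x1 y1)) := by
  have hψ4_zero : ∀ v, (∀ u, polar ψ4 u v = 0) → v = 0 := fun v hv =>
    hiso2.1 (LinearMap.ext fun u => by
      simpa [QuadraticMap.polarBilin_apply_apply, polar_comm ψ4 v u] using hv u)
  have hreg_zero : ∀ y : F4, (∀ w, d1 w • y = 0) → y = 0 := fun y hy => by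
    obtain ⟨w, hw⟩ := hreg
    obtain ⟨e⟩ := hrank
    apply e.injective
    have h := congrArg e (hy w)
    rw [map_smul, map_zero, smul_eq_mul, mul_comm] at h
    rw [map_zero]
    exact (mul_right_mem_nonZeroDivisors_eq_zero_iff hw).1 h
  have hcompat2_polar : ∀ x u v,
      polar ψ4 (ψ1 x (d2 u)) v + polar ψ4 (ψ1 x (d2 v)) u = N • (d1 x • polar ψ4 u v) := by
    intro x u v
    have h := hcompat2 x (u + v)
    simp only [map_add, QuadraticMap.polar_add_left, QuadraticMap.polar_add_right,
      hcompat2, QuadraticMap.map_add ψ4 u v, smul_add] at h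
    linear_combination (norm := module) h
  have hψ1_ψ1 : ∀ x u w,
      polar ψ4 (ψ1 x (d2 u)) (ψ1 x w) = N • (d1 w • polar ψ4 u (ψ1 x x)) := by
    intro x u w
    have h := hcompat2_polar x u (ψ1 x w)
    rw [hcompat1, map_zsmul, map_sub, map_smul, map_smul, polar_comm ψ4 (N • _) u] at h
    simp only [← QuadraticMap.polarBilin_apply_apply, map_sub, map_smul, map_zsmul] at h ⊢
    rw [smul_sub] at h
    linear_combination (norm := module) h
  let ψ3' := LinearEquiv.ofBijective ψ3.flip hiso3
  let γ : QuadraticMap P F1 (F1 →ₗ[P] F4) := β + N • ψ3.flip.compQuadraticMap χ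
  have hγ : ∀ x z, γ x z = β x z + N • ψ3 z (χ x) := fun x z => by simp [γ]
  have hγ_d2 : ∀ x u, γ x (d2 u) = 0 := fun x u => hreg_zero _ fun w => by
    have h : ψ3 (d2 u) (χ x) = - polar ψ4 u (ψ1 x x) := by rw [← hχ, hA3, neg_neg]
    rw [hγ, smul_add, hβ, hψ1_ψ1, hd21, h, zero_smul, smul_zero, smul_neg, smul_neg, add_zero,
      smul_comm (d1 w) N]
    abel
  have hψ3' : ∀ x z, ψ3 z (ψ3'.symm (γ x)) = γ x z := fun x z =>
    LinearMap.congr_fun (ψ3'.apply_symm_apply (γ x)) z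
  obtain ⟨r, hr⟩ := QuadraticMap.exists_compQuadraticMap_eq d4 hinj4
    (ψ3'.symm.toLinearMap.compQuadraticMap γ) fun x => by
      rw [hex3, LinearMap.mem_ker]
      refine hψ4_zero _ fun u => ?_
      rw [hA3]
      exact neg_eq_zero.2 ((hψ3' x (d2 u)).trans (hγ_d2 x u))
  have hr_apply : ∀ x z, d1 z • r x = β x z + N • ψ3 z (χ x) := fun x z => by
    rw [← hA2, hr, ← hγ]
    exact hψ3' x z
  refine ⟨r, hr_apply, fun x y z => ?_⟩
  simp only [QuadraticMap.polar, smul_sub, hr_apply, map_sub, LinearMap.sub_apply]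
  abel
end

section
/- For every x₁ ∈ F₁ one has (β(x₁))(x₁) = N·ψ₃(x₁, χ(x₁)). -/
open QuadraticMap LinearMap Submodule Function

theorem stmt_14
    (P : Type*) [CommRing P] [IsNoetherianRing P]
    (F1 F2 F3 F4 : Type*)
    [AddCommGroup F1] [Module P F1] [Module.Free P F1] [Module.Finite P F1]
    [AddCommGroup F2] [Module P F2] [Module.Free P F2] [Module.Finite P F2]
    [AddCommGroup F3] [Module P F3] [Module.Free P F3] [Module.Finite P F3]
    [AddCommGroup F4] [Module P F4] [Module.Free P F4] [Module.Finite P F4]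
    (d1 : F1 →ₗ[P] P) (d2 : F2 →ₗ[P] F1) (d3 : F3 →ₗ[P] F2) (d4 : F4 →ₗ[P] F3)
    (hd21 : ∀ x2, d1 (d2 x2) = 0) (hd32 : ∀ x3, d2 (d3 x3) = 0)
    (hd43 : ∀ x4, d3 (d4 x4) = 0)
    (hinj4 : Function.Injective d4)
    (hex3 : LinearMap.range d4 = LinearMap.ker d3)
    (hex2 : LinearMap.range d3 = LinearMap.ker d2)
    (hex1 : LinearMap.range d2 = LinearMap.ker d1)
    (hrank : Nonempty (F4 ≃ₗ[P] P))
    (ψ3 : F1 →ₗ[P] F3 →ₗ[P] F4) (ψ4 : QuadraticMap P F2 F4)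
    (hA2 : ∀ x1 x4, ψ3 x1 (d4 x4) = d1 x1 • x4)
    (hA3 : ∀ x2 x3, polar ψ4 x2 (d3 x3) = - ψ3 (d2 x2) x3)
    (hiso1 : Function.Bijective ψ3)
    (hiso2 : Function.Bijective (polarBilin ψ4))
    (hiso3 : Function.Bijective ψ3.flip)
    (hreg : ∃ x1, d1 x1 ∈ nonZeroDivisors P)
    (N : ℤ) (ψ1 : F1 →ₗ[P] F1 →ₗ[P] F2)
    (hcompat1 : ∀ x1 y1, d2 (ψ1 x1 y1) = N • (d1 x1 • y1 - d1 y1 • x1))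
    (hcompat2 : ∀ x1 x2, polar ψ4 (ψ1 x1 (d2 x2)) x2 = N • (d1 x1 • ψ4 x2))
    (χ : QuadraticMap P F1 F3)
    (hχ : ∀ x1, d3 (χ x1) = ψ1 x1 x1)
    (β : QuadraticMap P F1 (F1 →ₗ[P] F4))
    (hβ : ∀ x1 z1 w1, d1 w1 • β x1 z1 =
      polar ψ4 (ψ1 x1 z1) (ψ1 x1 w1) + N • (d1 z1 • ψ3 w1 (χ x1)))
    : ∀ x1, β x1 x1 = N • ψ3 x1 (χ x1) := by
  intro x
  obtain ⟨e⟩ := hrank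
  obtain ⟨w, hw⟩ := hreg
  have key : d1 w • β x x = d1 w • (N • ψ3 x (χ x)) := by
    rw [hβ x x w, ← hχ, polar_comm, hA3, hcompat1]
    simp only [map_zsmul, map_sub, map_smul, LinearMap.smul_apply, LinearMap.sub_apply,
      smul_sub, smul_comm N (d1 w)]
    abel
  apply e.injective
  have h := congrArg e key
  rw [map_smul, map_smul, smul_eq_mul, smul_eq_mul] at h
  exact (mul_cancel_left_mem_nonZeroDivisors hw).mp h
end

section
/- For every x₁ ∈ F₁ one has d₁(x₁)·r(x₁) = 2N·ψ₃(x₁, χ(x₁)). -/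
open QuadraticMap LinearMap Submodule Function

theorem stmt_15
    (P : Type*) [CommRing P] [IsNoetherianRing P]
    (F1 F2 F3 F4 : Type*)
    [AddCommGroup F1] [Module P F1] [Module.Free P F1] [Module.Finite P F1]
    [AddCommGroup F2] [Module P F2] [Module.Free P F2] [Module.Finite P F2]
    [AddCommGroup F3] [Module P F3] [Module.Free P F3] [Module.Finite P F3]
    [AddCommGroup F4] [Module P F4] [Module.Free P F4] [Module.Finite P F4]
    (d1 : F1 →ₗ[P] P) (d2 : F2 →ₗ[P] F1) (d3 : F3 →ₗ[P] F2) (d4 : F4 →ₗ[P] F3)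
    (hd21 : ∀ x2, d1 (d2 x2) = 0) (hd32 : ∀ x3, d2 (d3 x3) = 0)
    (hd43 : ∀ x4, d3 (d4 x4) = 0)
    (hinj4 : Function.Injective d4)
    (hex3 : LinearMap.range d4 = LinearMap.ker d3)
    (hex2 : LinearMap.range d3 = LinearMap.ker d2)
    (hex1 : LinearMap.range d2 = LinearMap.ker d1)
    (hrank : Nonempty (F4 ≃ₗ[P] P))
    (ψ3 : F1 →ₗ[P] F3 →ₗ[P] F4) (ψ4 : QuadraticMap P F2 F4)
    (hA2 : ∀ x1 x4, ψ3 x1 (d4 x4) = d1 x1 • x4)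
    (hA3 : ∀ x2 x3, polar ψ4 x2 (d3 x3) = - ψ3 (d2 x2) x3)
    (hiso1 : Function.Bijective ψ3)
    (hiso2 : Function.Bijective (polarBilin ψ4))
    (hiso3 : Function.Bijective ψ3.flip)
    (hreg : ∃ x1, d1 x1 ∈ nonZeroDivisors P)
    (N : ℤ) (ψ1 : F1 →ₗ[P] F1 →ₗ[P] F2)
    (hcompat1 : ∀ x1 y1, d2 (ψ1 x1 y1) = N • (d1 x1 • y1 - d1 y1 • x1))
    (hcompat2 : ∀ x1 x2, polar ψ4 (ψ1 x1 (d2 x2)) x2 = N • (d1 x1 • ψ4 x2))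
    (χ : QuadraticMap P F1 F3)
    (hχ : ∀ x1, d3 (χ x1) = ψ1 x1 x1)
    (β : QuadraticMap P F1 (F1 →ₗ[P] F4))
    (hβ : ∀ x1 z1 w1, d1 w1 • β x1 z1 =
      polar ψ4 (ψ1 x1 z1) (ψ1 x1 w1) + N • (d1 z1 • ψ3 w1 (χ x1)))
    (r : QuadraticMap P F1 F4)
    (hr1 : ∀ x1 z1, d1 z1 • r x1 = β x1 z1 + N • ψ3 z1 (χ x1))
    (hr2 : ∀ x1 y1 z1, d1 z1 • polar r x1 y1 = polar β x1 y1 z1 + N • ψ3 z1 (polar χ x1 y1))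
    : ∀ x1, d1 x1 • r x1 = (2 * N) • ψ3 x1 (χ x1) := by
  intro x
  obtain ⟨w, hw⟩ := hreg
  obtain ⟨e⟩ := hrank
  have cancel : ∀ a b : F4, d1 w • a = d1 w • b → a = b := by
    intro a b h
    apply e.injective
    have h' := congrArg e h
    simp only [map_smul, smul_eq_mul] at h'
    exact (mul_cancel_left_mem_nonZeroDivisors hw).1 h'
  have hpolar : polar ψ4 (ψ1 x x) (ψ1 x w) =
      N • (d1 w • ψ3 x (χ x)) - N • (d1 x • ψ3 w (χ x)) := by
    rw [polar_comm, ← hχ, hA3, hcompat1]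
    simp only [map_zsmul, map_sub, map_smul, LinearMap.smul_apply, LinearMap.sub_apply]
    module
  have hdiag : β x x = N • ψ3 x (χ x) := by
    apply cancel
    rw [hβ, hpolar, smul_comm (d1 w) N]
    abel
  rw [hr1, hdiag, mul_smul, two_smul]
end

section
/- For all x₁, y₁ ∈ F₁ one has (β̄(y₁,x₁))(x₁) + (β(x₁))(y₁) = N·ψ₃(x₁, χ̄(x₁,y₁)) + N·ψ₃(y₁, χ(x₁)). -/
open QuadraticMap LinearMap Submodule Function

theorem stmt_16
    (P : Type*) [CommRing P] [IsNoetherianRing P]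
    (F1 F2 F3 F4 : Type*)
    [AddCommGroup F1] [Module P F1] [Module.Free P F1] [Module.Finite P F1]
    [AddCommGroup F2] [Module P F2] [Module.Free P F2] [Module.Finite P F2]
    [AddCommGroup F3] [Module P F3] [Module.Free P F3] [Module.Finite P F3]
    [AddCommGroup F4] [Module P F4] [Module.Free P F4] [Module.Finite P F4]
    (d1 : F1 →ₗ[P] P) (d2 : F2 →ₗ[P] F1) (d3 : F3 →ₗ[P] F2) (d4 : F4 →ₗ[P] F3)
    (hd21 : ∀ x2, d1 (d2 x2) = 0) (hd32 : ∀ x3, d2 (d3 x3) = 0)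
    (hd43 : ∀ x4, d3 (d4 x4) = 0)
    (hinj4 : Function.Injective d4)
    (hex3 : LinearMap.range d4 = LinearMap.ker d3)
    (hex2 : LinearMap.range d3 = LinearMap.ker d2)
    (hex1 : LinearMap.range d2 = LinearMap.ker d1)
    (hrank : Nonempty (F4 ≃ₗ[P] P))
    (ψ3 : F1 →ₗ[P] F3 →ₗ[P] F4) (ψ4 : QuadraticMap P F2 F4)
    (hA2 : ∀ x1 x4, ψ3 x1 (d4 x4) = d1 x1 • x4)
    (hA3 : ∀ x2 x3, polar ψ4 x2 (d3 x3) = - ψ3 (d2 x2) x3)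
    (hiso1 : Function.Bijective ψ3)
    (hiso2 : Function.Bijective (polarBilin ψ4))
    (hiso3 : Function.Bijective ψ3.flip)
    (hreg : ∃ x1, d1 x1 ∈ nonZeroDivisors P)
    (N : ℤ) (ψ1 : F1 →ₗ[P] F1 →ₗ[P] F2)
    (hcompat1 : ∀ x1 y1, d2 (ψ1 x1 y1) = N • (d1 x1 • y1 - d1 y1 • x1))
    (hcompat2 : ∀ x1 x2, polar ψ4 (ψ1 x1 (d2 x2)) x2 = N • (d1 x1 • ψ4 x2))
    (χ : QuadraticMap P F1 F3)
    (hχ : ∀ x1, d3 (χ x1) = ψ1 x1 x1)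
    (β : QuadraticMap P F1 (F1 →ₗ[P] F4))
    (hβ : ∀ x1 z1 w1, d1 w1 • β x1 z1 =
      polar ψ4 (ψ1 x1 z1) (ψ1 x1 w1) + N • (d1 z1 • ψ3 w1 (χ x1)))
    : ∀ x1 y1, polar β y1 x1 x1 + β x1 y1 =
        N • ψ3 x1 (polar χ x1 y1) + N • ψ3 y1 (χ x1) := by
  intro x y
  obtain ⟨w, hw⟩ := hreg
  obtain ⟨e⟩ := hrank
  have hcancel : ∀ u v : F4, d1 w • u = d1 w • v → u = v := by
    intro u v h
    apply e.injective
    have h' := congrArg e h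
    rw [map_smul, map_smul, smul_eq_mul, smul_eq_mul] at h'
    exact (mul_cancel_left_mem_nonZeroDivisors hw).mp h'
  have hψ3 : ∀ x1 z1 x3, polar ψ4 (ψ1 x1 z1) (d3 x3) =
      - (N • (d1 x1 • ψ3 z1 x3 - d1 z1 • ψ3 x1 x3)) := by
    intro x1 z1 x3
    rw [hA3, hcompat1]
    simp
  have hχ_polar : ψ1 x y + ψ1 y x = d3 (polar χ x y) := by
    simp only [QuadraticMap.polar, map_sub, hχ, map_add, LinearMap.add_apply]
    abel
  have hβ_polar : d1 w • polar β y x x = polar ψ4 (ψ1 y x) (ψ1 x w) +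
      polar ψ4 (ψ1 x x) (ψ1 y w) + N • (d1 x • ψ3 w (polar χ x y)) := by
    simp only [polar_comm β y x]
    simp only [QuadraticMap.polar.eq_1 β, QuadraticMap.polar.eq_1 χ, LinearMap.sub_apply, smul_sub, hβ, map_add,
      map_sub, LinearMap.add_apply, polar_add_left, polar_add_right]
    abel
  have hsum : polar ψ4 (ψ1 x y) (ψ1 x w) + polar ψ4 (ψ1 y x) (ψ1 x w) =
      - (N • (d1 x • ψ3 w (polar χ x y) - d1 w • ψ3 x (polar χ x y))) := by
    rw [← polar_add_left, hχ_polar, polar_comm, hψ3]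
  have hdiag : polar ψ4 (ψ1 x x) (ψ1 y w) =
      - (N • (d1 y • ψ3 w (χ x) - d1 w • ψ3 y (χ x))) := by
    rw [← hχ, polar_comm, hψ3]
  apply hcancel
  rw [smul_add, hβ_polar, hβ, hdiag, smul_add, smul_comm (d1 w) N, smul_comm (d1 w) N]
  rw [← sub_eq_zero] at hsum ⊢
  rw [← hsum]
  simp only [smul_sub]
  abel
end

section
/- For all x₁, y₁ ∈ F₁ one has d₁(x₁)·r̄(x₁,y₁) + d₁(y₁)·r(x₁) = 2N·ψ₃(x₁, χ̄(x₁,y₁)) + 2N·ψ₃(y₁, χ(x₁)). -/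
open QuadraticMap LinearMap Submodule Function

theorem stmt_17
    (P : Type*) [CommRing P] [IsNoetherianRing P]
    (F1 F2 F3 F4 : Type*)
    [AddCommGroup F1] [Module P F1] [Module.Free P F1] [Module.Finite P F1]
    [AddCommGroup F2] [Module P F2] [Module.Free P F2] [Module.Finite P F2]
    [AddCommGroup F3] [Module P F3] [Module.Free P F3] [Module.Finite P F3]
    [AddCommGroup F4] [Module P F4] [Module.Free P F4] [Module.Finite P F4]
    (d1 : F1 →ₗ[P] P) (d2 : F2 →ₗ[P] F1) (d3 : F3 →ₗ[P] F2) (d4 : F4 →ₗ[P] F3)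
    (hd21 : ∀ x2, d1 (d2 x2) = 0) (hd32 : ∀ x3, d2 (d3 x3) = 0)
    (hd43 : ∀ x4, d3 (d4 x4) = 0)
    (hinj4 : Function.Injective d4)
    (hex3 : LinearMap.range d4 = LinearMap.ker d3)
    (hex2 : LinearMap.range d3 = LinearMap.ker d2)
    (hex1 : LinearMap.range d2 = LinearMap.ker d1)
    (hrank : Nonempty (F4 ≃ₗ[P] P))
    (ψ3 : F1 →ₗ[P] F3 →ₗ[P] F4) (ψ4 : QuadraticMap P F2 F4)
    (hA2 : ∀ x1 x4, ψ3 x1 (d4 x4) = d1 x1 • x4)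
    (hA3 : ∀ x2 x3, polar ψ4 x2 (d3 x3) = - ψ3 (d2 x2) x3)
    (hiso1 : Function.Bijective ψ3)
    (hiso2 : Function.Bijective (polarBilin ψ4))
    (hiso3 : Function.Bijective ψ3.flip)
    (hreg : ∃ x1, d1 x1 ∈ nonZeroDivisors P)
    (N : ℤ) (ψ1 : F1 →ₗ[P] F1 →ₗ[P] F2)
    (hcompat1 : ∀ x1 y1, d2 (ψ1 x1 y1) = N • (d1 x1 • y1 - d1 y1 • x1))
    (hcompat2 : ∀ x1 x2, polar ψ4 (ψ1 x1 (d2 x2)) x2 = N • (d1 x1 • ψ4 x2))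
    (χ : QuadraticMap P F1 F3)
    (hχ : ∀ x1, d3 (χ x1) = ψ1 x1 x1)
    (β : QuadraticMap P F1 (F1 →ₗ[P] F4))
    (hβ : ∀ x1 z1 w1, d1 w1 • β x1 z1 =
      polar ψ4 (ψ1 x1 z1) (ψ1 x1 w1) + N • (d1 z1 • ψ3 w1 (χ x1)))
    (r : QuadraticMap P F1 F4)
    (hr1 : ∀ x1 z1, d1 z1 • r x1 = β x1 z1 + N • ψ3 z1 (χ x1))
    (hr2 : ∀ x1 y1 z1, d1 z1 • polar r x1 y1 = polar β x1 y1 z1 + N • ψ3 z1 (polar χ x1 y1))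
    : ∀ x1 y1, d1 x1 • polar r x1 y1 + d1 y1 • r x1 =
        (2 * N) • ψ3 x1 (polar χ x1 y1) + (2 * N) • ψ3 y1 (χ x1) := by
  intro x y
  obtain ⟨e⟩ := hrank
  obtain ⟨w, hw⟩ := hreg
  have hskew : ψ1 x y + ψ1 y x = d3 (polar χ x y) := by
    simp only [QuadraticMap.polar, map_sub, hχ, map_add, LinearMap.add_apply]
    abel
  have hψ4 : ∀ a b x3, polar ψ4 (ψ1 a b) (d3 x3) =
      -(N • (d1 a • ψ3 b x3 - d1 b • ψ3 a x3)) := by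
    intro a b x3
    rw [hA3, hcompat1]
    simp
  have hpolar : d1 w • polar β x y x =
      polar ψ4 (ψ1 x x) (ψ1 y w) + polar ψ4 (ψ1 y x) (ψ1 x w)
        + N • (d1 x • ψ3 w (polar χ x y)) := by
    have hβxy : polar β x y x = β (x + y) x - β x x - β y x := rfl
    have hχxy : polar χ x y = χ (x + y) - χ x - χ y := rfl
    simp only [hβxy, hχxy, smul_sub, hβ, map_add, map_sub,
      LinearMap.add_apply, QuadraticMap.polar_add_left, QuadraticMap.polar_add_right]
    module
  have hdiag : polar ψ4 (ψ1 x x) (ψ1 y w) =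
      -(N • (d1 y • ψ3 w (χ x) - d1 w • ψ3 y (χ x))) := by
    rw [← hχ, QuadraticMap.polar_comm, hψ4]
  have hsum : polar ψ4 (ψ1 x y) (ψ1 x w) + polar ψ4 (ψ1 y x) (ψ1 x w) =
      -(N • (d1 x • ψ3 w (polar χ x y) - d1 w • ψ3 x (polar χ x y))) := by
    rw [← QuadraticMap.polar_add_left, hskew, QuadraticMap.polar_comm, hψ4]
  have hcancel : d1 w • (polar β x y x + β x y) =
      d1 w • (N • ψ3 x (polar χ x y) + N • ψ3 y (χ x)) := by
    rw [smul_add, hpolar, hβ x y w]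
    linear_combination (norm := module) hdiag + hsum
  have hkey : polar β x y x + β x y = N • ψ3 x (polar χ x y) + N • ψ3 y (χ x) := by
    apply e.injective
    apply (mul_cancel_left_mem_nonZeroDivisors hw).mp
    simpa only [map_smul, smul_eq_mul] using congrArg e hcancel
  rw [hr1, hr2]
  linear_combination (norm := module) hkey
end

section
/- (a) r vanishes on D₂G₁, i.e., r(x) = 0 and r̄(x,y) = 0 for all x, y ∈ G₁; and (b) ψ̄₄(ψ₁(x, w), ψ₁(x, z)) = 0 for all x ∈ G₁ and all z, w ∈ F₁. -/
open QuadraticMap LinearMap Submodule Function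

theorem stmt_18
    (P : Type*) [CommRing P] [IsNoetherianRing P]
    (F1 F2 F3 F4 : Type*)
    [AddCommGroup F1] [Module P F1] [Module.Free P F1] [Module.Finite P F1]
    [AddCommGroup F2] [Module P F2] [Module.Free P F2] [Module.Finite P F2]
    [AddCommGroup F3] [Module P F3] [Module.Free P F3] [Module.Finite P F3]
    [AddCommGroup F4] [Module P F4] [Module.Free P F4] [Module.Finite P F4]
    (d1 : F1 →ₗ[P] P) (d2 : F2 →ₗ[P] F1) (d3 : F3 →ₗ[P] F2) (d4 : F4 →ₗ[P] F3)
    (hd21 : ∀ x2, d1 (d2 x2) = 0) (hd32 : ∀ x3, d2 (d3 x3) = 0)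
    (hd43 : ∀ x4, d3 (d4 x4) = 0)
    (hinj4 : Function.Injective d4)
    (hex3 : LinearMap.range d4 = LinearMap.ker d3)
    (hex2 : LinearMap.range d3 = LinearMap.ker d2)
    (hex1 : LinearMap.range d2 = LinearMap.ker d1)
    (hrank : Nonempty (F4 ≃ₗ[P] P))
    (ψ3 : F1 →ₗ[P] F3 →ₗ[P] F4) (ψ4 : QuadraticMap P F2 F4)
    (hA2 : ∀ x1 x4, ψ3 x1 (d4 x4) = d1 x1 • x4)
    (hA3 : ∀ x2 x3, polar ψ4 x2 (d3 x3) = - ψ3 (d2 x2) x3)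
    (hiso1 : Function.Bijective ψ3)
    (hiso2 : Function.Bijective (polarBilin ψ4))
    (hiso3 : Function.Bijective ψ3.flip)
    (hreg : ∃ x1, d1 x1 ∈ nonZeroDivisors P)
    (N : ℤ) (ψ1 : F1 →ₗ[P] F1 →ₗ[P] F2)
    (hcompat1 : ∀ x1 y1, d2 (ψ1 x1 y1) = N • (d1 x1 • y1 - d1 y1 • x1))
    (hcompat2 : ∀ x1 x2, polar ψ4 (ψ1 x1 (d2 x2)) x2 = N • (d1 x1 • ψ4 x2))
    (χ : QuadraticMap P F1 F3)
    (hχ : ∀ x1, d3 (χ x1) = ψ1 x1 x1)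
    (β : QuadraticMap P F1 (F1 →ₗ[P] F4))
    (hβ : ∀ x1 z1 w1, d1 w1 • β x1 z1 =
      polar ψ4 (ψ1 x1 z1) (ψ1 x1 w1) + N • (d1 z1 • ψ3 w1 (χ x1)))
    (r : QuadraticMap P F1 F4)
    (hr1 : ∀ x1 z1, d1 z1 • r x1 = β x1 z1 + N • ψ3 z1 (χ x1))
    (hr2 : ∀ x1 y1 z1, d1 z1 • polar r x1 y1 = polar β x1 y1 z1 + N • ψ3 z1 (polar χ x1 y1))
    (G1 H1 I1 : Submodule P F1)
    (hsup : G1 ⊔ H1 ⊔ I1 = ⊤)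
    (hind1 : G1 ⊓ (H1 ⊔ I1) = ⊥)
    (hind2 : H1 ⊓ I1 = ⊥)
    (hH1 : ∃ h : F1, H1 = Submodule.span P {h} ∧ ∀ a : P, a • h = 0 → a = 0)
    (hχG1 : ∀ x ∈ G1, χ x = 0)
    (hχG2 : ∀ x ∈ G1, ∀ y ∈ G1, polar χ x y = 0)
    (hζ1 : G1 ≠ ⊥ → ∃ ζ ∈ G1, d1 ζ ∈ nonZeroDivisors P)
    : (∀ x ∈ G1, r x = 0) ∧
      (∀ x ∈ G1, ∀ y ∈ G1, polar r x y = 0) ∧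
      (∀ x ∈ G1, ∀ z w : F1, polar ψ4 (ψ1 x w) (ψ1 x z) = 0) := by
  have key : ∀ x ∈ G1, ∀ z w : F1,
      polar ψ4 (ψ1 x w) (ψ1 x z) = d1 z • d1 w • r x := by
    intro x hx z w
    have h := hβ x w z
    have h' := hr1 x w
    simp only [hχG1 x hx, map_zero, smul_zero, add_zero] at h h'
    rw [h', h]
  have hψ1 : ∀ x ∈ G1, ψ1 x x = 0 := by
    intro x hx
    rw [← hχ, hχG1 x hx, map_zero]
  have hr : ∀ x ∈ G1, r x = 0 := by
    intro x hx
    by_cases hG : G1 = ⊥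
    · rw [hG, Submodule.mem_bot] at hx
      rw [hx, QuadraticMap.map_zero]
    obtain ⟨ζ, hζ, hreg⟩ := hζ1 hG
    have cancel : ∀ v : F4, d1 ζ • v = 0 → v = 0 := by
      obtain ⟨e⟩ := hrank
      intro v hv
      apply e.injective
      rw [map_zero]
      apply (mem_nonZeroDivisors_iff.mp hreg).1
      rw [← smul_eq_mul, ← map_smul, hv, map_zero]
    have hsmul : ∀ y ∈ G1, d1 y • r y = 0 := by
      intro y hy
      apply cancel
      rw [← key y hy ζ y, hψ1 y hy, polar_zero_left]
    have htrans : r (x + ζ) = r x := by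
      rw [← sub_eq_zero]
      apply cancel
      apply cancel
      rw [smul_sub, smul_sub, ← key x hx, ← key _ (G1.add_mem hx hζ), map_add,
        LinearMap.add_apply, hψ1 ζ hζ, add_zero, sub_self]
    have h := hsmul _ (G1.add_mem hx hζ)
    rw [htrans, map_add, add_smul, hsmul x hx, zero_add] at h
    exact cancel _ h
  refine ⟨hr, fun x hx y hy => ?_, fun x hx z w => ?_⟩
  · simp [QuadraticMap.polar, hr _ hx, hr _ hy, hr _ (G1.add_mem hx hy)]
  · rw [key x hx, hr x hx, smul_zero, smul_zero]
end

section
/- Set N′ = 2N². Then there exists a P-bilinear map ψ₁′ : F₁ × F₁ → F₂ such that: (1) d₂(ψ₁′(x₁,y₁)) = N′·(d₁(x₁)·y₁ − d₁(y₁)·x₁) for all x₁, y₁ ∈ F₁; (2) ψ̄₄(ψ₁′(x₁, d₂x₂), x₂) = N′·d₁(x₁)·ψ₄(x₂) for all x₁ ∈ F₁, x₂ ∈ F₂; and (3) ψ₁′ vanishes on the image of D₂(G₁ ⊕ H₁), i.e., ψ₁′(x, x) = 0 and ψ₁′(x, y) + ψ₁′(y, x) = 0 for all x, y ∈ G₁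 ⊕ H₁. -/
open QuadraticMap LinearMap Submodule Function

/-- If every functional vanishing on `ker d` is a multiple of `d`, an element multiplied into a
principal ideal generated by a regular element by a power of each value of `d` lies in it. -/
theorem dvd_of_dvd_pow_mul {P F : Type*} [CommRing P] [IsNoetherianRing P]
    [AddCommGroup F] [Module P F] {d : F →ₗ[P] P}
    (hd : ∀ φ : F →ₗ[P] P, (∀ k, d k = 0 → φ k = 0) → ∃ v, ∀ y, φ y = v * d y)
    {z : F} (hz : d z ∈ nonZeroDivisors P) {a : P} (ha : a ∈ nonZeroDivisors P)
    {u : P} (n : ℕ) (hu : ∀ y, a ∣ d y ^ n * u) : a ∣ u := by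
  have cancel : ∀ s t : P, a * s = a * t → s = t := fun s t hst =>
    (mul_cancel_left_mem_nonZeroDivisors ha).1 hst
  have base : ∀ u : P, (∀ y, a ∣ d y * u) → a ∣ u := by
    intro u hu
    choose f hf using hu
    obtain ⟨v, hv⟩ := hd
      { toFun := f
        map_add' := fun x y => cancel _ _ <| by rw [mul_add, ← hf, ← hf, ← hf, map_add]; ring
        map_smul' := fun r x => cancel _ _ <| by
          simp only [RingHom.id_apply, smul_eq_mul, mul_left_comm a r, ← hf, map_smul]; ring }
      (fun k hk => cancel _ _ <| by
        change a * f k = a * 0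
        rw [← hf, hk]; ring)
    have hvz : f z = v * d z := hv z
    refine ⟨v, (mul_cancel_left_mem_nonZeroDivisors hz).1 ?_⟩
    rw [hf, hvz]; ring
  have pow : ∀ (m : ℕ) (u : P), (∀ r ∈ (LinearMap.range d : Ideal P) ^ m, a ∣ r * u) → a ∣ u := by
    intro m
    induction m with
    | zero => intro u h; simpa using h 1 (by simp)
    | succ m ih =>
      intro u h
      refine ih u fun r hr => base _ fun y => ?_
      rw [← mul_assoc, mul_comm (d y)]
      exact h _ (pow_succ (LinearMap.range d : Ideal P) m ▸ Ideal.mul_mem_mul hr ⟨y, rfl⟩)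
  let J : Ideal P := (Ideal.span {a}).colon {u}
  have hJ : ∀ r, r ∈ J ↔ a ∣ r * u := fun r => by
    simp [J, Submodule.mem_colon_singleton, Ideal.mem_span_singleton]
  obtain ⟨m, hm⟩ := Ideal.exists_pow_le_of_le_radical_of_fg
    (I := (LinearMap.range d : Ideal P)) (J := J)
    (by rintro _ ⟨y, rfl⟩; exact ⟨n, (hJ _).2 (hu y)⟩) (IsNoetherian.noetherian _)
  exact pow m u fun r hr => (hJ r).1 (hm hr)

/-- A linear functional all of whose values are divisible by a regular element can be divided. -/
theorem exists_linearMap_mul_eq {P F : Type*} [CommRing P] [AddCommGroup F] [Module P F]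
    {a : P} (ha : a ∈ nonZeroDivisors P) (φ : F →ₗ[P] P) (h : ∀ y, a ∣ φ y) :
    ∃ l : F →ₗ[P] P, ∀ y, φ y = a * l y := by
  have cancel : ∀ s t : P, a * s = a * t → s = t := fun s t hst =>
    (mul_cancel_left_mem_nonZeroDivisors ha).1 hst
  choose f hf using h
  exact ⟨{ toFun := f
           map_add' := fun x y => cancel _ _ <| by rw [mul_add, ← hf, ← hf, ← hf, map_add]
           map_smul' := fun r x => cancel _ _ <| by
            simp only [RingHom.id_apply, smul_eq_mul, mul_left_comm a r, ← hf, map_smul] }, hf⟩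

theorem QuadraticMap.map_smul_add_smul {P F M : Type*} [CommRing P] [AddCommGroup F] [Module P F]
    [AddCommGroup M] [Module P M] (χ : QuadraticMap P F M) (a b : P) (x y : F) :
    χ (a • x + b • y) = (a * a) • χ x + (b * b) • χ y + (a * b) • polar χ x y := by
  rw [QuadraticMap.map_add χ, QuadraticMap.map_smul, QuadraticMap.map_smul, polar_smul_left,
    polar_smul_right, smul_smul]

/-- The cubic form `x ↦ ψ x (χ x)`, vanishing on `ker d`, is divisible by `d`; the statement records
the quotient and its derivative at `h`, assuming that `χ` vanishes on `G`. -/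
theorem exists_cubic_quotient {P F M : Type*} [CommRing P] [IsNoetherianRing P]
    [AddCommGroup F] [Module P F] [AddCommGroup M] [Module P M] {d : F →ₗ[P] P}
    (hd : ∀ φ : F →ₗ[P] P, (∀ k, d k = 0 → φ k = 0) → ∃ v, ∀ y, φ y = v * d y)
    (ψ : F →ₗ[P] M →ₗ[P] P) (χ : QuadraticMap P F M)
    (hC : ∀ k, d k = 0 → ψ k (χ k) = 0)
    (hC1 : ∀ k k', d k = 0 → d k' = 0 → ψ k' (χ k) + ψ k (polar χ k k') = 0)
    {z : F} (hz : d z ∈ nonZeroDivisors P) (G : Submodule P F) (hzG : G = ⊥ ∨ z ∈ G)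
    (hχG1 : ∀ x ∈ G, χ x = 0) (hχG2 : ∀ x ∈ G, ∀ y ∈ G, polar χ x y = 0) (h : F) :
    ∃ (c : P) (e : F →ₗ[P] P), ψ h (χ h) = d h * c ∧
      (∀ y, ψ y (χ h) + ψ h (polar χ h y) = d y * c + d h * e y) ∧
      ∀ g ∈ G, ψ g (polar χ g h) = d g * e g := by
  have cancel : ∀ s t : P, d z * s = d z * t → s = t := fun s t hst =>
    (mul_cancel_left_mem_nonZeroDivisors hz).1 hst
  have two : ∀ x, polar χ x x = (2 : P) • χ x := fun x => by
    rw [polar_self, ofNat_smul_eq_nsmul P 2 (χ x)]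
  have hk : ∀ x, d (d z • x + (-d x) • z) = 0 := fun x => by
    simp only [map_add, map_smul, smul_eq_mul]; ring
  have cub : ∀ x, d z ^ 3 * ψ x (χ x) - d z ^ 2 * d x * (ψ z (χ x) + ψ x (polar χ x z))
      + d z * d x ^ 2 * (ψ x (χ z) + ψ z (polar χ x z)) - d x ^ 3 * ψ z (χ z) = 0 := by
    intro x
    have := hC _ (hk x)
    rw [QuadraticMap.map_smul_add_smul] at this
    simp only [map_add, map_smul, smul_eq_mul, LinearMap.add_apply, LinearMap.smul_apply] at this
    linear_combination this
  obtain ⟨q, hq⟩ : d z ∣ ψ z (χ z) := by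
    refine dvd_of_dvd_pow_mul hd hz hz 3 fun x => ⟨d z ^ 2 * ψ x (χ x)
      - d z * d x * (ψ z (χ x) + ψ x (polar χ x z))
      + d x ^ 2 * (ψ x (χ z) + ψ z (polar χ x z)), ?_⟩
    linear_combination - cub x
  have cub1 : ∀ x y, d z ^ 2 * (ψ y (χ x) + ψ x (polar χ x y))
      - d z * d x * (ψ x (polar χ z y) + ψ z (polar χ x y) + ψ y (polar χ x z))
      + d x ^ 2 * (ψ y (χ z) + ψ z (polar χ z y))
      - d y * d z * (ψ z (χ x) + ψ x (polar χ x z))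
      + 2 * d x * d y * (ψ x (χ z) + ψ z (polar χ x z)) - 3 * d y * d x ^ 2 * q = 0 := by
    intro x y
    apply cancel
    have := hC1 _ _ (hk x) (hk y)
    rw [QuadraticMap.map_smul_add_smul] at this
    simp only [polar_add_left, polar_add_right, polar_smul_left, polar_smul_right,
      two, map_add, map_smul, smul_eq_mul, LinearMap.add_apply,
      LinearMap.smul_apply] at this
    linear_combination this + 3 * d y * d x ^ 2 * hq
  let L : F →ₗ[P] P := ψ.flip (χ z) + ψ z ∘ₗ polarBilin χ z - q • d
  have hL : ∀ x, L x = ψ x (χ z) + ψ z (polar χ x z) - q * d x := fun x => by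
    simp [L, polar_comm χ x z]
  have hLL : ∀ x, d z ∣ d x ^ 2 * L x := fun x =>
    ⟨-(d z * ψ x (χ x) - d x * (ψ z (χ x) + ψ x (polar χ x z))), cancel _ _ <| by
      rw [hL]; linear_combination cub x + d x ^ 3 * hq⟩
  obtain ⟨l, hl⟩ := exists_linearMap_mul_eq hz L fun x => by
    refine dvd_of_dvd_pow_mul hd hz hz 3 fun y => ?_
    have h1 : d z ∣ d y ^ 2 * L x + 2 * d y * d x * L y :=
      ⟨-(d z * (ψ x (χ y) + ψ y (polar χ y x))
      - d y * (ψ y (polar χ z x) + ψ z (polar χ y x) + ψ x (polar χ y z))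
      - d x * (ψ z (χ y) + ψ y (polar χ y z))), by
        rw [hL, hL, polar_comm χ x z]; linear_combination cub1 y x⟩
    have h2 := dvd_sub (h1.mul_left (d y)) ((hLL y).mul_left (2 * d x))
    convert h2 using 1
    ring
  let Q : F → P := fun x => ψ z (χ x) + ψ x (polar χ x z) - d x * l x
  let B : F → F →ₗ[P] P := fun x => ψ x ∘ₗ polarBilin χ z + ψ z ∘ₗ polarBilin χ x
    + ψ.flip (polar χ x z) - d x • l - l x • d
  have hB : ∀ x y, B x y = ψ x (polar χ z y) + ψ z (polar χ x y) + ψ y (polar χ x z)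
      - d x * l y - l x * d y := fun x y => by simp [B]
  have hQ : ∀ x, Q x = ψ z (χ x) + ψ x (polar χ x z) - d x * l x := fun _ => rfl
  have hQadd : ∀ x y, B x y = Q (x + y) - Q x - Q y := fun x y => by
    simp only [hB, hQ, QuadraticMap.map_add χ, polar_add_left, map_add, LinearMap.add_apply,
      polar_comm χ z y]
    ring
  have hCQ : ∀ x, d z * ψ x (χ x) = d x * Q x := fun x => cancel _ _ <| cancel _ _ <| by
    have := hl x
    rw [hL] at this
    rw [hQ]; linear_combination cub x + d x ^ 3 * hq - d z * d x ^ 2 * this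
  have hC1Q : ∀ x y, d z * (ψ y (χ x) + ψ x (polar χ x y)) = d y * Q x + d x * B x y :=
    fun x y => cancel _ _ <| by
    have h1 := hl x
    have h2 := hl y
    rw [hL] at h1 h2
    rw [polar_comm χ y z] at h2
    rw [hQ, hB]; linear_combination cub1 x y - d x ^ 2 * h2 - 2 * d x * d y * h1
  have hBcomm : ∀ x y, B x y = B y x := fun x y => by rw [hQadd, hQadd, add_comm y x]; ring
  have hQdvd : ∀ x, d z ∣ Q x := fun x => by
    refine dvd_of_dvd_pow_mul hd hz hz 3 fun y => ?_
    refine ⟨d y ^ 2 * (ψ y (χ x) + ψ x (polar χ x y))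
      - d y * d x * (ψ x (χ y) + ψ y (polar χ y x)) + d x ^ 2 * ψ y (χ y), ?_⟩
    have h1 := hC1Q x y
    have h2 := hC1Q y x
    rw [hBcomm y x] at h2
    linear_combination - d y ^ 2 * h1 + d y * d x * h2 - d x ^ 2 * hCQ y
  obtain ⟨c, hc⟩ := hQdvd h
  obtain ⟨e, he⟩ := exists_linearMap_mul_eq hz (B h) fun y => by
    rw [hQadd]; exact dvd_sub (dvd_sub (hQdvd _) (hQdvd _)) (hQdvd _)
  refine ⟨c, e, cancel _ _ ?_, fun y => cancel _ _ ?_, fun g hg => ?_⟩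
  · rw [hCQ, hc]; ring
  · rw [hC1Q, hc, he]; ring
  · rcases hzG with rfl | hzG
    · obtain rfl : g = 0 := by simpa using hg
      simp
    · have hq0 : q = 0 := cancel _ _ <| by rw [← hq, hχG1 z hzG]; simp
      have hlg : l g = 0 := cancel _ _ <| by
        rw [← hl, hL, hχG1 z hzG, hχG2 g hg z hzG, hq0]; simp
      have hQg : Q g = 0 := by rw [hQ, hχG1 g hg, hχG2 g hg z hzG, hlg]; simp
      have := hC1Q g h
      rw [hQg, hBcomm, he, hχG1 g hg, map_zero] at this
      exact cancel _ _ (by linear_combination this)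

/-- Projection to the first summand and the coordinate on the rank one second summand. -/
theorem exists_projection_coordinate {P F : Type*} [CommRing P] [AddCommGroup F] [Module P F]
    (G I : Submodule P F) (h : F) (hfree : ∀ a : P, a • h = 0 → a = 0)
    (hsup : G ⊔ span P {h} ⊔ I = ⊤) (hGHI : G ⊓ (span P {h} ⊔ I) = ⊥)
    (hHI : span P {h} ⊓ I = ⊥) :
    ∃ (p : F →ₗ[P] F) (η : F →ₗ[P] P), (∀ x, p x ∈ G) ∧ (∀ g ∈ G, p g = g) ∧ p h = 0 ∧
      (∀ g ∈ G, η g = 0) ∧ η h = 1 := by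
  have hh : h ∈ span P {h} := mem_span_singleton_self h
  have c1 : IsCompl G (span P {h} ⊔ I) :=
    ⟨disjoint_iff.2 hGHI, codisjoint_iff.2 (by rw [← sup_assoc, hsup])⟩
  have c2 : IsCompl (span P {h}) (G ⊔ I) := by
    refine ⟨disjoint_iff.2 ?_, codisjoint_iff.2 (by rw [← sup_assoc, sup_comm _ G, hsup])⟩
    refine (Submodule.eq_bot_iff _).2 fun x hx => ?_
    obtain ⟨hxH, hxGI⟩ := hx
    obtain ⟨g, hg, i, hi, rfl⟩ := mem_sup.1 hxGI
    have hg0 : g ∈ G ⊓ (span P {h} ⊔ I) :=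
      ⟨hg, by simpa using sub_mem (mem_sup_left hxH) (mem_sup_right hi)⟩
    rw [hGHI, mem_bot] at hg0
    subst hg0
    rw [zero_add] at hxH ⊢
    have : i ∈ span P {h} ⊓ I := ⟨hxH, hi⟩
    rwa [hHI, mem_bot] at this
  have inj : ∀ s t : P, s • h = t • h → s = t := fun s t hst =>
    sub_eq_zero.1 (hfree _ (by rw [sub_smul, hst, sub_self]))
  choose f hf using fun x => mem_span_singleton.1 (projectionOnto _ _ c2 x).2
  refine ⟨Submodule.projection _ _ c1,
    { toFun := f
      map_add' := fun x y => inj _ _ <| by rw [add_smul, hf, hf, hf, map_add]; rfl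
      map_smul' := fun r x => inj _ _ <| by
        rw [RingHom.id_apply, smul_eq_mul, mul_smul, hf, hf, map_smul]; rfl },
    fun x => ?_, fun g hg => ?_, ?_, fun g hg => inj _ _ ?_, inj _ _ ?_⟩
  · exact Submodule.projection_apply_mem c1 x
  · exact Submodule.projection_apply_left c1 ⟨g, hg⟩
  · exact (Submodule.projection_apply_eq_zero_iff c1).2 (mem_sup_left hh)
  · change f g • h = _
    rw [hf, (projectionOnto_apply_eq_zero_iff c2).2 (mem_sup_left hg)]; simp
  · change f h • h = _
    rw [hf, one_smul]
    exact congrArg Subtype.val (projectionOnto_apply_left c2 ⟨h, hh⟩)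

theorem stmt_19
    (P : Type*) [CommRing P] [IsNoetherianRing P]
    (F1 F2 F3 F4 : Type*)
    [AddCommGroup F1] [Module P F1] [Module.Free P F1] [Module.Finite P F1]
    [AddCommGroup F2] [Module P F2] [Module.Free P F2] [Module.Finite P F2]
    [AddCommGroup F3] [Module P F3] [Module.Free P F3] [Module.Finite P F3]
    [AddCommGroup F4] [Module P F4] [Module.Free P F4] [Module.Finite P F4]
    (d1 : F1 →ₗ[P] P) (d2 : F2 →ₗ[P] F1) (d3 : F3 →ₗ[P] F2) (d4 : F4 →ₗ[P] F3)
    (hd21 : ∀ x2, d1 (d2 x2) = 0) (hd32 : ∀ x3, d2 (d3 x3) = 0)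
    (hd43 : ∀ x4, d3 (d4 x4) = 0)
    (hinj4 : Function.Injective d4)
    (hex3 : LinearMap.range d4 = LinearMap.ker d3)
    (hex2 : LinearMap.range d3 = LinearMap.ker d2)
    (hex1 : LinearMap.range d2 = LinearMap.ker d1)
    (hrank : Nonempty (F4 ≃ₗ[P] P))
    (ψ3 : F1 →ₗ[P] F3 →ₗ[P] F4) (ψ4 : QuadraticMap P F2 F4)
    (hA2 : ∀ x1 x4, ψ3 x1 (d4 x4) = d1 x1 • x4)
    (hA3 : ∀ x2 x3, polar ψ4 x2 (d3 x3) = - ψ3 (d2 x2) x3)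
    (hiso1 : Function.Bijective ψ3)
    (hiso2 : Function.Bijective (polarBilin ψ4))
    (hiso3 : Function.Bijective ψ3.flip)
    (hreg : ∃ x1, d1 x1 ∈ nonZeroDivisors P)
    (N : ℤ) (ψ1 : F1 →ₗ[P] F1 →ₗ[P] F2)
    (hcompat1 : ∀ x1 y1, d2 (ψ1 x1 y1) = N • (d1 x1 • y1 - d1 y1 • x1))
    (hcompat2 : ∀ x1 x2, polar ψ4 (ψ1 x1 (d2 x2)) x2 = N • (d1 x1 • ψ4 x2))
    (χ : QuadraticMap P F1 F3)
    (hχ : ∀ x1, d3 (χ x1) = ψ1 x1 x1)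
    (G1 H1 I1 : Submodule P F1)
    (hsup : G1 ⊔ H1 ⊔ I1 = ⊤)
    (hind1 : G1 ⊓ (H1 ⊔ I1) = ⊥)
    (hind2 : H1 ⊓ I1 = ⊥)
    (hH1 : ∃ h : F1, H1 = Submodule.span P {h} ∧ ∀ a : P, a • h = 0 → a = 0)
    (hχG1 : ∀ x ∈ G1, χ x = 0)
    (hχG2 : ∀ x ∈ G1, ∀ y ∈ G1, polar χ x y = 0)
    (hζ1 : G1 ≠ ⊥ → ∃ ζ ∈ G1, d1 ζ ∈ nonZeroDivisors P)
    : ∃ ψ1' : F1 →ₗ[P] F1 →ₗ[P] F2,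
      (∀ x1 y1, d2 (ψ1' x1 y1) = (2 * N ^ 2) • (d1 x1 • y1 - d1 y1 • x1)) ∧
      (∀ x1 x2, polar ψ4 (ψ1' x1 (d2 x2)) x2 = (2 * N ^ 2) • (d1 x1 • ψ4 x2)) ∧
      (∀ x ∈ G1 ⊔ H1, ψ1' x x = 0) ∧
      (∀ x ∈ G1 ⊔ H1, ∀ y ∈ G1 ⊔ H1, ψ1' x y + ψ1' y x = 0) := by
  obtain ⟨ε⟩ := hrank
  obtain ⟨h, rfl, hfree⟩ := hH1
  obtain ⟨p, η, hpG, hpid, hph, hηG, hηh⟩ :=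
    exists_projection_coordinate G1 I1 h hfree hsup hind1 hind2
  have hK : ∀ k, d1 k = 0 → ∃ x, d2 x = k := fun k hk =>
    (hex1 ▸ LinearMap.mem_ker.2 hk : k ∈ LinearMap.range d2)
  have hd : ∀ φ : F1 →ₗ[P] P, (∀ k, d1 k = 0 → φ k = 0) → ∃ v, ∀ y, φ y = v * d1 y := by
    intro φ hφ
    obtain ⟨w, hw⟩ := hiso3.2 (ε.symm.toLinearMap ∘ₗ φ)
    have hw' : ∀ y, ψ3 y w = ε.symm (φ y) := fun y => LinearMap.congr_fun hw y
    have h3 : d3 w = 0 := hiso2.1 <| LinearMap.ext fun x => by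
      rw [map_zero, LinearMap.zero_apply, polarBilin_apply_apply, polar_comm, hA3, hw',
        hφ _ (hd21 x), map_zero, neg_zero]
    obtain ⟨v, rfl⟩ := (hex3 ▸ LinearMap.mem_ker.2 h3 : w ∈ LinearMap.range d4)
    refine ⟨ε v, fun y => ?_⟩
    have := congrArg ε (hw' y)
    rw [hA2, map_smul, LinearEquiv.apply_symm_apply] at this
    rw [← this, smul_eq_mul, mul_comm]
  have hχp : ∀ x y, d3 (polar χ x y) = ψ1 x y + ψ1 y x := fun x y => by
    simp only [QuadraticMap.polar, map_sub, hχ, map_add, LinearMap.add_apply]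
    abel
  have hC1 : ∀ k k', d1 k = 0 → d1 k' = 0 → ψ3 k' (χ k) + ψ3 k (polar χ k k') = 0 := by
    intro k k' hk hk'
    obtain ⟨x, rfl⟩ := hK k hk
    obtain ⟨y, rfl⟩ := hK k' hk'
    have hxx := hcompat2 (d2 x) x
    have hyy := hcompat2 (d2 x) y
    have hxy := hcompat2 (d2 x) (x + y)
    have hyx := hcompat2 (d2 y) x
    simp only [hd21, zero_smul, smul_zero, map_add, polar_add_left, polar_add_right] at *
    rw [← neg_eq_zero, neg_add, ← hA3, ← hA3, hχ, hχp, polar_add_right, polar_comm _ y,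
      polar_comm _ x, polar_comm _ x, hyx]
    rw [hxx, hyy] at hxy
    simpa [add_comm] using hxy
  have hC : ∀ k, d1 k = 0 → ψ3 k (χ k) = 0 := by
    intro k hk
    obtain ⟨x, rfl⟩ := hK k hk
    rw [← neg_eq_zero, ← hA3, hχ, polar_comm, hcompat2, hd21, zero_smul, smul_zero]
  obtain ⟨z, hz, hzG⟩ : ∃ z, d1 z ∈ nonZeroDivisors P ∧ (G1 = ⊥ ∨ z ∈ G1) := by
    by_cases hG : G1 = ⊥
    · obtain ⟨z, hz⟩ := hreg
      exact ⟨z, hz, Or.inl hG⟩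
    · obtain ⟨z, hzG, hz⟩ := hζ1 hG
      exact ⟨z, hz, Or.inr hzG⟩
  obtain ⟨c, e, hc, hce, he⟩ := exists_cubic_quotient hd (ψ3.compr₂ ε.toLinearMap) χ
    (fun k hk => by simp [hC k hk])
    (fun k k' hk hk' => by
      simpa only [LinearMap.compr₂_apply, LinearEquiv.coe_coe, map_add, map_zero]
        using congrArg ε (hC1 k k' hk hk'))
    hz G1 hzG hχG1 hχG2 h
  simp only [LinearMap.compr₂_apply, LinearEquiv.coe_coe] at hc hce he
  let Γ : F1 →ₗ[P] F3 := - η.smulRight (χ h) - polarBilin χ h ∘ₗ p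
    + (c • η + e ∘ₗ p).smulRight (d4 (ε.symm 1))
  have hΓ : ∀ y, Γ y = - (η y • χ h) - polar χ h (p y)
      + (c * η y + e (p y)) • d4 (ε.symm 1) := fun y => by simp [Γ]
  let u : F1 →ₗ[P] F1 := p + η.smulRight h
  have hu : ∀ y, u y = p y + η y • h := fun y => by simp [u]
  have hΓu : ∀ y, ψ3 (u y) (Γ y) = 0 := fun y => ε.injective <| by
    have h1 := hce (p y)
    have h2 := he (p y) (hpG y)
    rw [polar_comm χ (p y) h] at h2
    rw [hΓ, hu]
    simp only [map_add, map_sub, map_neg, map_smul, LinearMap.add_apply, LinearMap.smul_apply, hA2,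
      smul_eq_mul, LinearEquiv.apply_symm_apply, map_zero]
    linear_combination - η y ^ 2 * hc - η y * h1 - h2
  let E : F3 ≃ₗ[P] (F1 →ₗ[P] F4) := LinearEquiv.ofBijective ψ3.flip hiso3
  let a : F1 →ₗ[P] F3 := Γ - E.symm.toLinearMap ∘ₗ ψ3.compl₂ Γ ∘ₗ (LinearMap.id - u)
  have ha : ∀ y z, ψ3 z (a y) = ψ3 z (Γ y) - ψ3 (y - u y) (Γ z) := fun y z => by
    have : ∀ f, ψ3 z (E.symm f) = f z := fun f =>
      LinearMap.congr_fun (E.apply_symm_apply f) z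
    simp [a, this]
  have haa : ∀ y, ψ3 y (a y) = 0 := fun y => by
    rw [ha, map_sub, LinearMap.sub_apply, hΓu, sub_zero, sub_self]
  have hdiag : ∀ x ∈ G1 ⊔ span P {h}, ψ1 x x + η x • d3 (a x) = 0 := by
    intro x hx
    obtain ⟨g, hg, w, hw, rfl⟩ := mem_sup.1 hx
    obtain ⟨t, rfl⟩ := mem_span_singleton.1 hw
    have hp : p (g + t • h) = g := by simp [hpid g hg, hph]
    have hη : η (g + t • h) = t := by simp [hηG g hg, hηh]
    have hax : a (g + t • h) = Γ (g + t • h) := by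
      simp [a, hu, hpid g hg, hph, hηG g hg, hηh]
    have hχx := QuadraticMap.map_smul_add_smul χ 1 t g h
    rw [one_smul, hχG1 g hg, polar_comm, smul_zero, zero_add, one_mul] at hχx
    rw [hax, hΓ, hp, hη, ← hχ, hχx]
    simp only [map_add, map_sub, map_neg, map_smul, hd43]
    module
  refine ⟨(2 * N) • (ψ1 + η.smulRight (d3 ∘ₗ a)), ?_, ?_, ?_⟩
  · intro x y
    simp only [LinearMap.smul_apply, LinearMap.add_apply, LinearMap.smulRight_apply,
      LinearMap.comp_apply, map_zsmul, map_add, map_smul, hcompat1, hd32, smul_zero, add_zero]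
    rw [smul_smul]
    ring_nf
  · intro x w
    have h0 : polar ψ4 (d3 (a (d2 w))) w = 0 := by rw [polar_comm, hA3, haa, neg_zero]
    have h1 := hcompat2 x w
    rw [← polarBilin_apply_apply] at h0 h1 ⊢
    simp only [LinearMap.smul_apply, LinearMap.add_apply, LinearMap.smulRight_apply,
      LinearMap.comp_apply, map_zsmul, map_add, map_smul, h0, h1, smul_zero, add_zero]
    rw [smul_smul]
    ring_nf
  · have hzero : ∀ x ∈ G1 ⊔ span P {h},
        ((2 * N) • (ψ1 + η.smulRight (d3 ∘ₗ a))) x x = 0 := fun x hx => by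
      simpa using congrArg ((2 * N) • ·) (hdiag x hx)
    refine ⟨hzero, fun x hx y hy => ?_⟩
    have hxy := hzero _ (add_mem hx hy)
    rw [map_add, map_add, LinearMap.add_apply, LinearMap.add_apply, hzero x hx, hzero y hy,
      zero_add, add_zero] at hxy
    rwa [add_comm]
end
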